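/- Let μ,ν>0 with Sc=ν/μ, let ε,η>0, set κ_η=(η/ν³)^{1/6} and κ_β=(η/μ³)^{1/6}, and fix constants c1,…,c7>0. Let t be a tracer spectrum (2D framework) with shell sums 𝐭, dissipation rate χ and wavenumber κ_θ, and let κ0 ≤ κg < κf⁻ ≤ κf⁺ < κ_η with 4κg ≤ κf⁻ and 4κf⁺ ≤ κ_η. Assume: (i) c1·κ_η²/ln(κ_η/κf⁺) ≤ η/ε ≤ c2·κ_η²/ln(κ_η/κf⁺); (ii) for every κ∈[κg,κf⁻], c3·χ·ε^{-1/3}·κ^{-2/3} ≤ 𝐭_{κ,2κ} ≤ c4·χ·ε^{-1/3}·κ^{-2/3}; (iii) for every κ∈[κf⁺,κ_η], c5·χ·η^{-1/3}·[(ln(2κ/κf⁺))^{2/3} − (ln(κ/κf⁺))^{2/3}] ≤ 𝐭_{κ,2κ} ≤ c6·χ·η^{-1/3}·[(ln(2κ/κf⁺))^{2/3} − (ln(κ/κf⁺))^{2/3}]; (iv) 𝐭_{κ0,∞} ≤ c7·(𝐭_{κg,κf⁻} + 𝐭_{κf⁺,κ_η}). Then there exist constants c,C>0 depending only on c1,…,c7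 such that c ≤ κ_θ²·(a+b′) ≤ C, where a = κ_β^{-4/3}·Sc^{-1/3}·(κg^{-2/3} − (κf⁻)^{-2/3})·(ln(κ_η/κf⁺))^{-1/3} and b′ = κ_β^{-2}·(ln(κ_η/κf⁺))^{2/3}. (The log-corrected version of Theorem 5.1 derived in Section 5.3.) -/

import Mathlib

open Real

/-- Euclidean norm of a lattice vector `k ∈ ℤ^d`. -/
noncomputable def knorm {d : ℕ} (k : Fin d → ℤ) : ℝ :=
  Real.sqrt (∑ i, ((k i : ℝ)) ^ 2)

/-- Shell sum `𝐭_{κ1,κ2}` (finite upper end). -/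
noncomputable def shellSum (d : ℕ) (L κ0 : ℝ) (t : (Fin d → ℤ) → ℝ) (κ1 κ2 : ℝ) : ℝ :=
  L ^ (-(d : ℤ)) * ∑' k : Fin d → ℤ,
    (if κ1 ≤ κ0 * knorm k ∧ κ0 * knorm k < κ2 then t k else 0)

/-- Shell sum `𝐭_{κ1,∞}`. -/
noncomputable def shellSumTop (d : ℕ) (L κ0 : ℝ) (t : (Fin d → ℤ) → ℝ) (κ1 : ℝ) : ℝ :=
  L ^ (-(d : ℤ)) * ∑' k : Fin d → ℤ, (if κ1 ≤ κ0 * knorm k then t k else 0)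

/-- Tracer dissipation rate `χ = μ L^{-d} κ0² Σ_k |k|² t(k)`. -/
noncomputable def chiRate (d : ℕ) (L κ0 μ : ℝ) (t : (Fin d → ℤ) → ℝ) : ℝ :=
  μ * L ^ (-(d : ℤ)) * κ0 ^ 2 * ∑' k : Fin d → ℤ, knorm k ^ 2 * t k

/-- Indicator wavenumber squared, `κ_θ² = κ0² Σ|k|²t(k) / Σ t(k)`. -/
noncomputable def kThetaSq (d : ℕ) (κ0 : ℝ) (t : (Fin d → ℤ) → ℝ) : ℝ :=
  κ0 ^ 2 * (∑' k : Fin d → ℤ, knorm k ^ 2 * t k) / (∑' k : Fin d → ℤ, t k)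

/-- A (discrete) tracer spectrum: nonnegative, vanishing at `k = 0`, not identically
zero, and with `Σ (1+|k|²) t(k) < ∞`. -/
structure IsTracerSpectrum (d : ℕ) (t : (Fin d → ℤ) → ℝ) : Prop where
  nonneg : ∀ k, 0 ≤ t k
  map_zero : t 0 = 0
  exists_ne_zero : ∃ k, t k ≠ 0
  summable : Summable fun k : Fin d → ℤ => (1 + knorm k ^ 2) * t k

section ShellSums

variable {d : ℕ} {L κ0 : ℝ} {t : (Fin d → ℤ) → ℝ}

theorem IsTracerSpectrum.summable_self (ht : IsTracerSpectrum d t) : Summable t :=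
  ht.summable.of_nonneg_of_le ht.nonneg fun k =>
    le_mul_of_one_le_left (ht.nonneg k) (by nlinarith [sq_nonneg (knorm k)])

theorem IsTracerSpectrum.summable_ite (ht : IsTracerSpectrum d t) (p : (Fin d → ℤ) → Prop)
    [DecidablePred p] : Summable fun k => if p k then t k else 0 :=
  ht.summable_self.of_nonneg_of_le
    (fun k => by split_ifs <;> [exact ht.nonneg k; exact le_rfl])
    (fun k => by split_ifs <;> [exact le_rfl; exact ht.nonneg k])

theorem shellSum_nonneg (hL : 0 < L) (ht : IsTracerSpectrum d t) (κ1 κ2 : ℝ) :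
    0 ≤ shellSum d L κ0 t κ1 κ2 :=
  mul_nonneg (by positivity)
    (tsum_nonneg fun k => by split_ifs <;> [exact ht.nonneg k; exact le_rfl])

theorem shellSum_add (ht : IsTracerSpectrum d t) {κ1 κ2 κ3 : ℝ} (h12 : κ1 ≤ κ2) (h23 : κ2 ≤ κ3) :
    shellSum d L κ0 t κ1 κ2 + shellSum d L κ0 t κ2 κ3 = shellSum d L κ0 t κ1 κ3 := by
  unfold shellSum
  rw [← mul_add, ← (ht.summable_ite _).tsum_add (ht.summable_ite _)]
  congr 2 with k
  split_ifs <;> grind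

theorem shellSum_mono_right (hL : 0 < L) (ht : IsTracerSpectrum d t) {κ1 κ2 κ3 : ℝ}
    (h12 : κ1 ≤ κ2) (h23 : κ2 ≤ κ3) :
    shellSum d L κ0 t κ1 κ2 ≤ shellSum d L κ0 t κ1 κ3 := by
  rw [← shellSum_add ht h12 h23]
  exact le_add_of_nonneg_right (shellSum_nonneg hL ht _ _)

theorem shellSum_le_shellSumTop (hL : 0 < L) (ht : IsTracerSpectrum d t) {κ κ1 κ2 : ℝ}
    (h : κ ≤ κ1) : shellSum d L κ0 t κ1 κ2 ≤ shellSumTop d L κ0 t κ := by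
  unfold shellSum shellSumTop
  refine mul_le_mul_of_nonneg_left ?_ (by positivity)
  refine (ht.summable_ite _).tsum_le_tsum (fun k => ?_) (ht.summable_ite _)
  have := ht.nonneg k
  split_ifs <;> grind

theorem shellSum_dyadic (ht : IsTracerSpectrum d t) {κ : ℝ} (hκ : 0 < κ) (N : ℕ) :
    ∑ j ∈ Finset.range N, shellSum d L κ0 t (2 ^ j * κ) (2 * (2 ^ j * κ)) =
      shellSum d L κ0 t κ (2 ^ N * κ) := by
  induction N with
  | zero =>
    have h : ∀ k : Fin d → ℤ, ¬ (κ ≤ κ0 * knorm k ∧ κ0 * knorm k < 2 ^ 0 * κ) := fun k h => by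
      linarith [h.1, h.2]
    simp only [shellSum, h]
    simp
  | succ n ih =>
    have h1 : κ ≤ 2 ^ n * κ := le_mul_of_one_le_left hκ.le (one_le_pow₀ (by norm_num))
    rw [Finset.sum_range_succ, ih, shellSum_add ht h1 (by linarith)]
    congr 1
    ring

theorem one_le_knorm {k : Fin d → ℤ} (hk : k ≠ 0) : 1 ≤ knorm k := by
  obtain ⟨i, hi⟩ := Function.ne_iff.mp hk
  refine Real.one_le_sqrt.mpr ?_
  have h1 : (1 : ℝ) ≤ (k i : ℝ) ^ 2 := by
    exact_mod_cast Int.add_one_le_of_lt (sq_pos_of_ne_zero hi)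
  exact h1.trans (Finset.single_le_sum (f := fun i => (k i : ℝ) ^ 2)
    (fun i _ => sq_nonneg _) (Finset.mem_univ i))

theorem shellSumTop_fundamental (ht : IsTracerSpectrum d t) (hκ0 : 0 < κ0) :
    shellSumTop d L κ0 t κ0 = L ^ (-(d : ℤ)) * ∑' k, t k := by
  unfold shellSumTop
  congr 2 with k
  rcases eq_or_ne k 0 with rfl | hk
  · simp [ht.map_zero]
  · rw [if_pos (le_mul_of_one_le_right hκ0.le (one_le_knorm hk))]

theorem IsTracerSpectrum.tsum_pos (ht : IsTracerSpectrum d t) : 0 < ∑' k, t k := by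
  obtain ⟨k, hk⟩ := ht.exists_ne_zero
  exact ht.summable_self.tsum_pos ht.nonneg k ((ht.nonneg k).lt_of_ne' hk)

theorem chiRate_nonneg {μ : ℝ} (hL : 0 < L) (hμ : 0 < μ) (ht : IsTracerSpectrum d t) :
    0 ≤ chiRate d L κ0 μ t :=
  mul_nonneg (by positivity) (tsum_nonneg fun k => mul_nonneg (sq_nonneg _) (ht.nonneg k))

theorem kThetaSq_eq_chiRate_div {μ : ℝ} (hL : 0 < L) (hμ : 0 < μ) (ht : IsTracerSpectrum d t)
    (hκ0 : 0 < κ0) :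
    kThetaSq d κ0 t = chiRate d L κ0 μ t / (μ * shellSumTop d L κ0 t κ0) := by
  rw [shellSumTop_fundamental ht hκ0]
  have h1 := ht.tsum_pos
  have h2 : 0 < L ^ (-(d : ℤ)) := by positivity
  unfold kThetaSq chiRate
  field_simp

theorem two_rpow_neg_two_thirds_le : (2 : ℝ) ^ (-2 / 3 : ℝ) ≤ 3 / 4 := by
  refine le_of_pow_le_pow_left₀ (n := 3) (by norm_num) (by norm_num) ?_
  rw [← Real.rpow_natCast, ← Real.rpow_mul (by norm_num)]
  norm_num [Real.rpow_neg]

theorem shellSum_le_of_rpow_bound (hL : 0 < L) (ht : IsTracerSpectrum d t) {A κ1 κ2 : ℝ}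
    (hA : 0 ≤ A) (hκ1 : 0 < κ1) (h12 : κ1 ≤ κ2)
    (h : ∀ κ, κ1 ≤ κ → κ ≤ κ2 → shellSum d L κ0 t κ (2 * κ) ≤ A * κ ^ (-2 / 3 : ℝ)) :
    shellSum d L κ0 t κ1 κ2 ≤ 4 * A * κ1 ^ (-2 / 3 : ℝ) := by
  obtain ⟨N, hN1, hN2⟩ := exists_nat_pow_near ((one_le_div hκ1).mpr h12) one_lt_two
  rw [le_div_iff₀ hκ1] at hN1
  rw [div_lt_iff₀ hκ1] at hN2
  have hP : 0 < κ1 ^ (-2 / 3 : ℝ) := by positivity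
  have hgeom : ∀ n : ℕ, ∑ j ∈ Finset.range n, (3 / 4 : ℝ) ^ j ≤ 4 := fun n => by
    have : (0 : ℝ) < (3 / 4) ^ n := by positivity
    rw [geom_sum_eq (by norm_num), div_le_iff_of_neg (by norm_num)]
    linarith
  calc shellSum d L κ0 t κ1 κ2 ≤ shellSum d L κ0 t κ1 (2 ^ (N + 1) * κ1) :=
        shellSum_mono_right hL ht h12 hN2.le
    _ = ∑ j ∈ Finset.range (N + 1), shellSum d L κ0 t (2 ^ j * κ1) (2 * (2 ^ j * κ1)) :=
        (shellSum_dyadic ht hκ1 _).symm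
    _ ≤ ∑ j ∈ Finset.range (N + 1), A * κ1 ^ (-2 / 3 : ℝ) * (3 / 4 : ℝ) ^ j := by
        refine Finset.sum_le_sum fun j hj => ?_
        have hjN : j ≤ N := Nat.lt_succ_iff.mp (Finset.mem_range.mp hj)
        have hle : (2 : ℝ) ^ j * κ1 ≤ κ2 :=
          (mul_le_mul_of_nonneg_right (pow_le_pow_right₀ one_le_two hjN) hκ1.le).trans hN1
        refine (h _ (le_mul_of_one_le_left hκ1.le (one_le_pow₀ one_le_two)) hle).trans ?_
        rw [mul_assoc]
        refine mul_le_mul_of_nonneg_left ?_ hA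
        rw [Real.mul_rpow (by positivity) hκ1.le, mul_comm, ← Real.rpow_natCast_mul two_pos.le,
          mul_comm (j : ℝ), Real.rpow_mul_natCast two_pos.le]
        exact mul_le_mul_of_nonneg_left
          (pow_le_pow_left₀ (by positivity) two_rpow_neg_two_thirds_le _) hP.le
    _ ≤ A * κ1 ^ (-2 / 3 : ℝ) * 4 := by
        rw [← Finset.mul_sum]
        exact mul_le_mul_of_nonneg_left (hgeom _) (by positivity)
    _ = 4 * A * κ1 ^ (-2 / 3 : ℝ) := by ring

theorem log_dyadic_increment {κ : ℝ} (hκ : 0 < κ) (j : ℕ) :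
    Real.log (2 * (2 ^ j * κ) / κ) ^ (2 / 3 : ℝ) - Real.log (2 ^ j * κ / κ) ^ (2 / 3 : ℝ) =
      (((j + 1 : ℕ) : ℝ) * Real.log 2) ^ (2 / 3 : ℝ) - ((j : ℝ) * Real.log 2) ^ (2 / 3 : ℝ) := by
  rw [← mul_assoc, ← pow_succ', mul_div_cancel_right₀ _ hκ.ne', mul_div_cancel_right₀ _ hκ.ne',
    Real.log_pow, Real.log_pow]

theorem sum_log_dyadic_increment {κ : ℝ} (hκ : 0 < κ) (A : ℝ) (N : ℕ) :
    ∑ j ∈ Finset.range N, A * (Real.log (2 * (2 ^ j * κ) / κ) ^ (2 / 3 : ℝ)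
        - Real.log (2 ^ j * κ / κ) ^ (2 / 3 : ℝ)) =
      A * ((N : ℝ) * Real.log 2) ^ (2 / 3 : ℝ) := by
  simp_rw [log_dyadic_increment hκ]
  rw [← Finset.mul_sum, Finset.sum_range_sub fun j : ℕ => ((j : ℝ) * Real.log 2) ^ (2 / 3 : ℝ)]
  norm_num

theorem shellSum_le_of_log_bound (hL : 0 < L) (ht : IsTracerSpectrum d t) {A κ1 κ2 : ℝ}
    (hA : 0 ≤ A) (hκ1 : 0 < κ1) (h12 : 4 * κ1 ≤ κ2)
    (h : ∀ κ, κ1 ≤ κ → κ ≤ κ2 → shellSum d L κ0 t κ (2 * κ) ≤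
      A * (Real.log (2 * κ / κ1) ^ (2 / 3 : ℝ) - Real.log (κ / κ1) ^ (2 / 3 : ℝ))) :
    shellSum d L κ0 t κ1 κ2 ≤ 2 * A * Real.log (κ2 / κ1) ^ (2 / 3 : ℝ) := by
  have h4 : 4 ≤ κ2 / κ1 := (le_div_iff₀ hκ1).mpr h12
  obtain ⟨N, hN1, hN2⟩ := exists_nat_pow_near (x := κ2 / κ1) (by linarith) one_lt_two
  have hlogN : N * Real.log 2 ≤ Real.log (κ2 / κ1) := by
    rw [← Real.log_pow]
    exact Real.log_le_log (by positivity) hN1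
  have hlog2 : Real.log 2 ≤ Real.log (κ2 / κ1) := Real.log_le_log two_pos (by linarith)
  have hlog0 : 0 < Real.log 2 := Real.log_pos one_lt_two
  rw [le_div_iff₀ hκ1] at hN1
  rw [div_lt_iff₀ hκ1] at hN2
  calc shellSum d L κ0 t κ1 κ2 ≤ shellSum d L κ0 t κ1 (2 ^ (N + 1) * κ1) :=
        shellSum_mono_right hL ht (by linarith) hN2.le
    _ = ∑ j ∈ Finset.range (N + 1), shellSum d L κ0 t (2 ^ j * κ1) (2 * (2 ^ j * κ1)) :=
        (shellSum_dyadic ht hκ1 _).symm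
    _ ≤ A * (((N + 1 : ℕ) : ℝ) * Real.log 2) ^ (2 / 3 : ℝ) := by
        rw [← sum_log_dyadic_increment hκ1]
        refine Finset.sum_le_sum fun j hj => ?_
        have hjN : j ≤ N := Nat.lt_succ_iff.mp (Finset.mem_range.mp hj)
        exact h _ (le_mul_of_one_le_left hκ1.le (one_le_pow₀ one_le_two))
          ((mul_le_mul_of_nonneg_right (pow_le_pow_right₀ one_le_two hjN) hκ1.le).trans hN1)
    _ ≤ A * (2 * Real.log (κ2 / κ1)) ^ (2 / 3 : ℝ) := by
        refine mul_le_mul_of_nonneg_left (Real.rpow_le_rpow (by positivity) ?_ (by norm_num)) hA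
        push_cast
        linarith
    _ ≤ A * (2 * Real.log (κ2 / κ1) ^ (2 / 3 : ℝ)) := by
        rw [Real.mul_rpow two_pos.le (by linarith)]
        have : (2 : ℝ) ^ (2 / 3 : ℝ) ≤ 2 :=
          Real.rpow_le_self_of_one_le one_le_two (by norm_num)
        have : 0 ≤ Real.log (κ2 / κ1) ^ (2 / 3 : ℝ) := Real.rpow_nonneg (by linarith) _
        gcongr
    _ = 2 * A * Real.log (κ2 / κ1) ^ (2 / 3 : ℝ) := by ring

theorem le_shellSum_of_log_bound (hL : 0 < L) (ht : IsTracerSpectrum d t) {A κ1 κ2 : ℝ}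
    (hA : 0 ≤ A) (hκ1 : 0 < κ1) (h12 : 4 * κ1 ≤ κ2)
    (h : ∀ κ, κ1 ≤ κ → κ ≤ κ2 →
      A * (Real.log (2 * κ / κ1) ^ (2 / 3 : ℝ) - Real.log (κ / κ1) ^ (2 / 3 : ℝ)) ≤
        shellSum d L κ0 t κ (2 * κ)) :
    1 / 2 * A * Real.log (κ2 / κ1) ^ (2 / 3 : ℝ) ≤ shellSum d L κ0 t κ1 κ2 := by
  have h4 : 4 ≤ κ2 / κ1 := (le_div_iff₀ hκ1).mpr h12
  obtain ⟨N, hN1, hN2⟩ := exists_nat_pow_near (x := κ2 / κ1) (by linarith) one_lt_two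
  have hlogN : Real.log (κ2 / κ1) ≤ (N + 1) * Real.log 2 := by
    have := Real.log_le_log (by linarith) hN2.le
    rw [Real.log_pow] at this
    exact_mod_cast this
  have hlog0 : 0 < Real.log 2 := Real.log_pos one_lt_two
  have hlog : 0 < Real.log (κ2 / κ1) := Real.log_pos (by linarith)
  have hN : (1 : ℝ) ≤ N := by
    norm_cast
    by_contra! hN
    obtain rfl : N = 0 := by lia
    linarith [hN2.trans_eq (pow_one (2 : ℝ))]
  rw [le_div_iff₀ hκ1] at hN1
  have h1N : κ1 ≤ 2 ^ N * κ1 := le_mul_of_one_le_left hκ1.le (one_le_pow₀ one_le_two)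
  calc 1 / 2 * A * Real.log (κ2 / κ1) ^ (2 / 3 : ℝ)
      = A * (1 / 2 * Real.log (κ2 / κ1) ^ (2 / 3 : ℝ)) := by ring
    _ ≤ A * ((1 / 2) * Real.log (κ2 / κ1)) ^ (2 / 3 : ℝ) := by
        rw [Real.mul_rpow (by norm_num) hlog.le]
        have : (1 / 2 : ℝ) ≤ (1 / 2) ^ (2 / 3 : ℝ) :=
          Real.self_le_rpow_of_le_one (by norm_num) (by norm_num) (by norm_num)
        gcongr
    _ ≤ A * ((N : ℝ) * Real.log 2) ^ (2 / 3 : ℝ) := by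
        refine mul_le_mul_of_nonneg_left (Real.rpow_le_rpow (by positivity) ?_ (by norm_num)) hA
        nlinarith
    _ ≤ ∑ j ∈ Finset.range N, shellSum d L κ0 t (2 ^ j * κ1) (2 * (2 ^ j * κ1)) := by
        rw [← sum_log_dyadic_increment hκ1]
        refine Finset.sum_le_sum fun j hj => ?_
        have hjN : j ≤ N := (Finset.mem_range.mp hj).le
        exact h _ (le_mul_of_one_le_left hκ1.le (one_le_pow₀ one_le_two))
          ((mul_le_mul_of_nonneg_right (pow_le_pow_right₀ one_le_two hjN) hκ1.le).trans hN1)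
    _ = shellSum d L κ0 t κ1 (2 ^ N * κ1) := shellSum_dyadic ht hκ1 _
    _ ≤ shellSum d L κ0 t κ1 κ2 := shellSum_mono_right hL ht h1N hN1

end ShellSums

theorem rpow_neg_two_thirds_le_sub {x y : ℝ} (hx : 0 < x) (hxy : 4 * x ≤ y) :
    x ^ (-2 / 3 : ℝ) ≤ 16 / 7 * (x ^ (-2 / 3 : ℝ) - y ^ (-2 / 3 : ℝ)) := by
  have h1 : y ^ (-2 / 3 : ℝ) ≤ (4 * x) ^ (-2 / 3 : ℝ) :=
    Real.rpow_le_rpow_of_nonpos (by positivity) hxy (by norm_num)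
  have h2 : (4 * x) ^ (-2 / 3 : ℝ) ≤ 9 / 16 * x ^ (-2 / 3 : ℝ) := by
    rw [Real.mul_rpow (by norm_num) hx.le, show (4 : ℝ) = 2 * 2 by norm_num,
      Real.mul_rpow two_pos.le two_pos.le]
    have := two_rpow_neg_two_thirds_le
    have h0 : (0 : ℝ) < 2 ^ (-2 / 3 : ℝ) := by positivity
    gcongr
    nlinarith
  linarith

theorem dissipation_rpow_eq {ε η : ℝ} (hε : 0 < ε) (hη : 0 < η) :
    ε ^ (-1 / 3 : ℝ) = (η / ε) ^ (1 / 3 : ℝ) * η ^ (-1 / 3 : ℝ) := by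
  rw [Real.div_rpow hη.le hε.le, show (-1 / 3 : ℝ) = -(1 / 3) by norm_num,
    Real.rpow_neg hε.le, Real.rpow_neg hη.le]
  have : 0 < η ^ (1 / 3 : ℝ) := by positivity
  field_simp

theorem batchelor_rpow_neg_two {η μ : ℝ} (hη : 0 < η) (hμ : 0 < μ) :
    ((η / μ ^ 3) ^ (1 / 6 : ℝ)) ^ (-2 : ℝ) = μ * η ^ (-1 / 3 : ℝ) := by
  refine Real.log_injOn_pos (Set.mem_Ioi.mpr (by positivity)) (Set.mem_Ioi.mpr (by positivity)) ?_
  rw [Real.log_rpow (by positivity), Real.log_rpow (by positivity),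
    Real.log_div hη.ne' (by positivity), Real.log_mul hμ.ne' (by positivity), Real.log_rpow hη,
    Real.log_pow]
  push_cast
  ring

theorem kolmogorov_mul_rpow {η μ ν l c : ℝ} (hη : 0 < η) (hμ : 0 < μ) (hν : 0 < ν) (hl : 0 < l)
    (hc : 0 < c) :
    (c * ((η / ν ^ 3) ^ (1 / 6 : ℝ)) ^ 2 / l) ^ (1 / 3 : ℝ) * η ^ (-1 / 3 : ℝ) * μ =
      c ^ (1 / 3 : ℝ) * (((η / μ ^ 3) ^ (1 / 6 : ℝ)) ^ (-4 / 3 : ℝ) * (ν / μ) ^ (-1 / 3 : ℝ) *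
        l ^ (-1 / 3 : ℝ)) := by
  refine Real.log_injOn_pos (Set.mem_Ioi.mpr (by positivity)) (Set.mem_Ioi.mpr (by positivity)) ?_
  rw [Real.log_mul (by positivity) hμ.ne', Real.log_mul (by positivity) (by positivity),
    Real.log_rpow (by positivity), Real.log_div (by positivity) hl.ne',
    Real.log_mul hc.ne' (by positivity), Real.log_pow, Real.log_rpow (by positivity),
    Real.log_div hη.ne' (by positivity), Real.log_pow, Real.log_rpow hη,
    Real.log_mul (by positivity) (by positivity), Real.log_mul (by positivity) (by positivity),
    Real.log_mul (by positivity) (by positivity), Real.log_rpow hc,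
    Real.log_rpow (by positivity), Real.log_rpow (by positivity),
    Real.log_div hη.ne' (by positivity), Real.log_pow, Real.log_rpow (by positivity),
    Real.log_div hν.ne' hμ.ne', Real.log_rpow hl]
  push_cast
  ring

/-- Section 5.3: the log-corrected version of Theorem 5.1. -/
theorem tracer_2D_log_corrected
    (c1 c2 c3 c4 c5 c6 c7 : ℝ)
    (hc1 : 0 < c1) (hc2 : 0 < c2) (hc3 : 0 < c3) (hc4 : 0 < c4)
    (hc5 : 0 < c5) (hc6 : 0 < c6) (hc7 : 0 < c7) :
    ∃ c C : ℝ, 0 < c ∧ 0 < C ∧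
      ∀ (L μ ν ε η κg κfm κfp κ0 Sc κη κβ χ a b' : ℝ) (t : (Fin 2 → ℤ) → ℝ),
        0 < L → 0 < μ → 0 < ν → 0 < ε → 0 < η →
        IsTracerSpectrum 2 t →
        κ0 = 2 * π / L →
        Sc = ν / μ →
        κη = (η / ν ^ 3) ^ (1 / 6 : ℝ) →
        κβ = (η / μ ^ 3) ^ (1 / 6 : ℝ) →
        χ = chiRate 2 L κ0 μ t →
        a = κβ ^ (-4 / 3 : ℝ) * Sc ^ (-1 / 3 : ℝ)
              * (κg ^ (-2 / 3 : ℝ) - κfm ^ (-2 / 3 : ℝ))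
              * (Real.log (κη / κfp)) ^ (-1 / 3 : ℝ) →
        b' = κβ ^ (-2 : ℝ) * (Real.log (κη / κfp)) ^ (2 / 3 : ℝ) →
        κ0 ≤ κg → κg < κfm → κfm ≤ κfp → κfp < κη →
        4 * κg ≤ κfm → 4 * κfp ≤ κη →
        (c1 * κη ^ 2 / Real.log (κη / κfp) ≤ η / ε ∧
          η / ε ≤ c2 * κη ^ 2 / Real.log (κη / κfp)) →
        (∀ κ, κg ≤ κ → κ ≤ κfm →
          c3 * χ * ε ^ (-1 / 3 : ℝ) * κ ^ (-2 / 3 : ℝ) ≤ shellSum 2 L κ0 t κ (2 * κ) ∧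
          shellSum 2 L κ0 t κ (2 * κ) ≤ c4 * χ * ε ^ (-1 / 3 : ℝ) * κ ^ (-2 / 3 : ℝ)) →
        (∀ κ, κfp ≤ κ → κ ≤ κη →
          c5 * χ * η ^ (-1 / 3 : ℝ) *
              ((Real.log (2 * κ / κfp)) ^ (2 / 3 : ℝ) - (Real.log (κ / κfp)) ^ (2 / 3 : ℝ)) ≤
            shellSum 2 L κ0 t κ (2 * κ) ∧
          shellSum 2 L κ0 t κ (2 * κ) ≤
            c6 * χ * η ^ (-1 / 3 : ℝ) *
              ((Real.log (2 * κ / κfp)) ^ (2 / 3 : ℝ) - (Real.log (κ / κfp)) ^ (2 / 3 : ℝ))) →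
        shellSumTop 2 L κ0 t κ0 ≤ c7 * (shellSum 2 L κ0 t κg κfm + shellSum 2 L κ0 t κfp κη) →
        c ≤ kThetaSq 2 κ0 t * (a + b') ∧ kThetaSq 2 κ0 t * (a + b') ≤ C := by
  set p : ℝ := min (c3 * c1 ^ (1 / 3 : ℝ)) (1 / 2 * c5) / 2 with hp
  set q : ℝ := c7 * max (64 / 7 * c4 * c2 ^ (1 / 3 : ℝ)) (2 * c6) with hq
  have hp0 : 0 < p := by positivity
  have hq0 : 0 < q := by positivity
  refine ⟨q⁻¹, p⁻¹, by positivity, by positivity, ?_⟩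
  intro L μ ν ε η κg κfm κfp κ0 Sc κη κβ χ a b' t hL hμ hν hε hη ht hκ0 hSc hκη hκβ hχ ha hb
    hg0 _ hmp _ hg4 hf4 hi hii hiii hiv
  have hκ0pos : 0 < κ0 := by rw [hκ0]; positivity
  have hκg : 0 < κg := hκ0pos.trans_le hg0
  have hκfp : 0 < κfp := by linarith
  have hl : 0 < Real.log (κη / κfp) :=
    Real.log_pos (by rw [lt_div_iff₀ hκfp]; linarith)
  set l := Real.log (κη / κfp)
  have hχ0 : 0 ≤ χ := hχ ▸ chiRate_nonneg hL hμ ht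
  have hS : 0 < shellSumTop 2 L κ0 t κ0 := by
    rw [shellSumTop_fundamental ht hκ0pos]
    exact mul_pos (by positivity) ht.tsum_pos
  rw [kThetaSq_eq_chiRate_div hL hμ ht hκ0pos, ← hχ]
  set S := shellSumTop 2 L κ0 t κ0
  set δ := κg ^ (-2 / 3 : ℝ) - κfm ^ (-2 / 3 : ℝ) with hδdef
  have hδ := rpow_neg_two_thirds_le_sub hκg hg4
  rw [← hδdef] at hδ
  have hκgp : 0 < κg ^ (-2 / 3 : ℝ) := by positivity
  have hfmp : 0 < κfm ^ (-2 / 3 : ℝ) := Real.rpow_pos_of_pos (by linarith) _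
  have hδ0 : 0 < δ := by linarith
  set G := κβ ^ (-4 / 3 : ℝ) * Sc ^ (-1 / 3 : ℝ) * l ^ (-1 / 3 : ℝ) with hG
  have haG : a = G * δ := by rw [ha, hG]; ring
  have hbη : b' = μ * η ^ (-1 / 3 : ℝ) * l ^ (2 / 3 : ℝ) := by
    rw [hb, hκβ, batchelor_rpow_neg_two hη hμ]
  have hlow : c1 ^ (1 / 3 : ℝ) * G ≤ ε ^ (-1 / 3 : ℝ) * μ := by
    rw [hG, hκβ, hSc, ← kolmogorov_mul_rpow hη hμ hν hl hc1, ← hκη, dissipation_rpow_eq hε hη]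
    refine mul_le_mul_of_nonneg_right (mul_le_mul_of_nonneg_right
      (Real.rpow_le_rpow (by positivity) hi.1 (by norm_num)) (by positivity)) hμ.le
  have hupp : ε ^ (-1 / 3 : ℝ) * μ ≤ c2 ^ (1 / 3 : ℝ) * G := by
    rw [hG, hκβ, hSc, ← kolmogorov_mul_rpow hη hμ hν hl hc2, ← hκη, dissipation_rpow_eq hε hη]
    refine mul_le_mul_of_nonneg_right (mul_le_mul_of_nonneg_right
      (Real.rpow_le_rpow (by positivity) hi.2 (by norm_num)) (by positivity)) hμ.le
  have hG0 : 0 < G := by rw [hG, hκβ, hSc]; positivity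
  have ha0 : 0 < a := by rw [haG]; positivity
  have hb0 : 0 < b' := by rw [hbη]; positivity
  have hT1_upper : μ * shellSum 2 L κ0 t κg κfm ≤ 64 / 7 * c4 * c2 ^ (1 / 3 : ℝ) * (χ * a) := by
    have h := shellSum_le_of_rpow_bound hL ht (A := c4 * χ * ε ^ (-1 / 3 : ℝ)) (by positivity)
      hκg (by linarith) fun κ h1 h2 => (hii κ h1 h2).2
    calc μ * shellSum 2 L κ0 t κg κfm
        ≤ μ * (4 * (c4 * χ * ε ^ (-1 / 3 : ℝ)) * κg ^ (-2 / 3 : ℝ)) := by gcongr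
      _ = 4 * c4 * χ * (ε ^ (-1 / 3 : ℝ) * μ) * κg ^ (-2 / 3 : ℝ) := by ring
      _ ≤ 4 * c4 * χ * (c2 ^ (1 / 3 : ℝ) * G) * (16 / 7 * δ) := by gcongr
      _ = 64 / 7 * c4 * c2 ^ (1 / 3 : ℝ) * (χ * a) := by rw [haG]; ring
  have hT1_lower : c3 * c1 ^ (1 / 3 : ℝ) * (χ * a) ≤ μ * shellSum 2 L κ0 t κg κfm := by
    calc c3 * c1 ^ (1 / 3 : ℝ) * (χ * a)
        = c3 * χ * (c1 ^ (1 / 3 : ℝ) * G) * δ := by rw [haG]; ring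
      _ ≤ c3 * χ * (ε ^ (-1 / 3 : ℝ) * μ) * κg ^ (-2 / 3 : ℝ) := by
          gcongr
          linarith
      _ = μ * (c3 * χ * ε ^ (-1 / 3 : ℝ) * κg ^ (-2 / 3 : ℝ)) := by ring
      _ ≤ μ * shellSum 2 L κ0 t κg κfm := by
          gcongr
          exact (hii κg le_rfl (by linarith)).1.trans
            (shellSum_mono_right hL ht (by linarith) (by linarith))
  have hT2_upper : μ * shellSum 2 L κ0 t κfp κη ≤ 2 * c6 * (χ * b') := by
    have h := shellSum_le_of_log_bound hL ht (A := c6 * χ * η ^ (-1 / 3 : ℝ)) (by positivity)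
      hκfp hf4 fun κ h1 h2 => (hiii κ h1 h2).2
    calc μ * shellSum 2 L κ0 t κfp κη
        ≤ μ * (2 * (c6 * χ * η ^ (-1 / 3 : ℝ)) * l ^ (2 / 3 : ℝ)) := by gcongr
      _ = 2 * c6 * (χ * b') := by rw [hbη]; ring
  have hT2_lower : 1 / 2 * c5 * (χ * b') ≤ μ * shellSum 2 L κ0 t κfp κη := by
    have h := le_shellSum_of_log_bound hL ht (A := c5 * χ * η ^ (-1 / 3 : ℝ)) (by positivity)
      hκfp hf4 fun κ h1 h2 => (hiii κ h1 h2).1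
    calc 1 / 2 * c5 * (χ * b')
        = μ * (1 / 2 * (c5 * χ * η ^ (-1 / 3 : ℝ)) * l ^ (2 / 3 : ℝ)) := by rw [hbη]; ring
      _ ≤ μ * shellSum 2 L κ0 t κfp κη := by gcongr
  have hχa : 0 ≤ χ * a := by positivity
  have hχb : 0 ≤ χ * b' := by positivity
  have hS_upper : μ * S ≤ q * (χ * (a + b')) := by
    calc μ * S ≤ μ * (c7 * (shellSum 2 L κ0 t κg κfm + shellSum 2 L κ0 t κfp κη)) := by gcongr
      _ = c7 * (μ * shellSum 2 L κ0 t κg κfm + μ * shellSum 2 L κ0 t κfp κη) := by ring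
      _ ≤ c7 * (max (64 / 7 * c4 * c2 ^ (1 / 3 : ℝ)) (2 * c6) * (χ * a)
            + max (64 / 7 * c4 * c2 ^ (1 / 3 : ℝ)) (2 * c6) * (χ * b')) := by
          refine mul_le_mul_of_nonneg_left (add_le_add ?_ ?_) hc7.le
          · exact hT1_upper.trans (mul_le_mul_of_nonneg_right (le_max_left _ _) hχa)
          · exact hT2_upper.trans (mul_le_mul_of_nonneg_right (le_max_right _ _) hχb)
      _ = q * (χ * (a + b')) := by rw [hq]; ring
  have hS_lower : p * (χ * (a + b')) ≤ μ * S := by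
    have h1 : min (c3 * c1 ^ (1 / 3 : ℝ)) (1 / 2 * c5) * (χ * a) ≤ μ * S :=
      (mul_le_mul_of_nonneg_right (min_le_left _ _) hχa).trans (hT1_lower.trans
        (mul_le_mul_of_nonneg_left (shellSum_le_shellSumTop hL ht hg0) hμ.le))
    have h2 : min (c3 * c1 ^ (1 / 3 : ℝ)) (1 / 2 * c5) * (χ * b') ≤ μ * S :=
      (mul_le_mul_of_nonneg_right (min_le_right _ _) hχb).trans (hT2_lower.trans
        (mul_le_mul_of_nonneg_left (shellSum_le_shellSumTop hL ht (by linarith)) hμ.le))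
    calc p * (χ * (a + b')) = (min (c3 * c1 ^ (1 / 3 : ℝ)) (1 / 2 * c5) * (χ * a)
          + min (c3 * c1 ^ (1 / 3 : ℝ)) (1 / 2 * c5) * (χ * b')) / 2 := by rw [hp]; ring
      _ ≤ μ * S := by linarith
  rw [div_mul_eq_mul_div]
  constructor
  · rwa [le_div_iff₀ (by positivity), inv_mul_le_iff₀ hq0]
  · rwa [div_le_iff₀ (by positivity), ← div_eq_inv_mul, le_div_iff₀ hp0, mul_comm]
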